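/- arXiv:0811.2277 — 4 statements merged into one kernel-verified Lean document; each statement's English description precedes it below -/
import Mathlib

section
/- Let u : ℍ → ℝ be radial, H-convex, and continuously differentiable on ℝ³. Then for every t ∈ ℝ and R ≥ 0 there exists R' ≥ 0 such that ∂_H u(C(t,R)) = {p ∈ ℝ² : |p| = R'}, where C(t,R) = {(x,y,t) ∈ ℍ : x² + y² = R²}. -/
noncomputable section

open Filter Topology Set
open scoped ENNReal

/-- The underlying set of the Heisenberg group `ℍ = ℝ³`, points `(x, y, t)`. -/
abbrev Hgrp : Type := ℝ × ℝ × ℝ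

/-- Heisenberg group law `(x,y,t)·(x',y',t') = (x+x', y+y', t+t'+2(x'y−xy'))`. -/
def hmul (g g' : Hgrp) : Hgrp :=
  (g.1 + g'.1, g.2.1 + g'.2.1,
    g.2.2 + g'.2.2 + 2 * (g'.1 * g.2.1 - g.1 * g'.2.1))

/-- Inverse in the Heisenberg group. -/
def hinv (g : Hgrp) : Hgrp := (-g.1, -g.2.1, -g.2.2)

/-- Anisotropic dilation `δ_λ(x,y,t) = (λx, λy, λ²t)`. -/
def hdil (l : ℝ) (g : Hgrp) : Hgrp := (l * g.1, l * g.2.1, l ^ 2 * g.2.2)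

/-- Horizontal projection `ξ₁(x,y,t) = (x,y)`. -/
def xi1 (g : Hgrp) : ℝ × ℝ := (g.1, g.2.1)

/-- Exponential of a horizontal vector: `exp (a,b) = (a,b,0)`. -/
def hexp (v : ℝ × ℝ) : Hgrp := (v.1, v.2, 0)

/-- Euclidean inner product on `ℝ²`. -/
def dot (p q : ℝ × ℝ) : ℝ := p.1 * q.1 + p.2 * q.2

/-- Euclidean norm on `ℝ²`. -/
def enorm2 (p : ℝ × ℝ) : ℝ := Real.sqrt (p.1 ^ 2 + p.2 ^ 2)

/-- The horizontal plane `H_{g₀} = {(x,y,t) : t = t₀ + 2y₀x − 2x₀y}`. -/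
def hplane (g0 : Hgrp) : Set Hgrp :=
  {g | g.2.2 = g0.2.2 + 2 * g0.2.1 * g.1 - 2 * g0.1 * g.2.1}

/-- The H-subdifferential `∂_H u(g₀)` of `u : Ω → ℝ` at `g₀`. -/
def hsub (Ω : Set Hgrp) (u : Hgrp → ℝ) (g0 : Hgrp) : Set (ℝ × ℝ) :=
  {p | ∀ g ∈ hplane g0 ∩ Ω, u g ≥ u g0 + dot p (xi1 g - xi1 g0)}

/-- The H-normal map: `∂_H u(E) = ⋃_{g ∈ E} ∂_H u(g)`. -/
def hsubSet (Ω : Set Hgrp) (u : Hgrp → ℝ) (E : Set Hgrp) : Set (ℝ × ℝ) :=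
  ⋃ g ∈ E, hsub Ω u g

/-- H-convexity of a set. -/
def HConvexSet (Ω : Set Hgrp) : Prop :=
  ∀ g ∈ Ω, ∀ g' ∈ hplane g ∩ Ω, ∀ l ∈ Set.Icc (0:ℝ) 1,
    hmul g (hdil l (hmul (hinv g) g')) ∈ Ω

/-- H-convexity (weak H-convexity) of a function on `Ω`. -/
def HConvexOn (Ω : Set Hgrp) (u : Hgrp → ℝ) : Prop :=
  ∀ g ∈ Ω, ∀ g' ∈ hplane g ∩ Ω, ∀ l ∈ Set.Icc (0:ℝ) 1,
    u (hmul g (hdil l (hmul (hinv g) g'))) ≤ u g + l * (u g' - u g)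

/-- Strict H-convexity of a function on all of `ℍ`. -/
def StrictHConvexOn (u : Hgrp → ℝ) : Prop :=
  HConvexOn Set.univ u ∧
    ∀ g : Hgrp, ∀ g' ∈ hplane g, g ≠ g' → ∀ l ∈ Set.Icc (0:ℝ) 1,
      u (hmul g (hdil l (hmul (hinv g) g'))) = u g + l * (u g' - u g) →
        l = 0 ∨ l = 1

/-- The Korányi gauge `‖(x,y,t)‖_ℍ = ((x²+y²)² + t²)^{1/4}`. -/
def kgauge (g : Hgrp) : ℝ := ((g.1 ^ 2 + g.2.1 ^ 2) ^ 2 + g.2.2 ^ 2) ^ ((1:ℝ)/4)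

/-- The Korányi distance `ρ(g,g') = ‖g⁻¹·g'‖_ℍ`. -/
def kdist (g g' : Hgrp) : ℝ := kgauge (hmul (hinv g) g')

/-- A function on `ℍ` is radial if `u(x,y,t) = U(√(x²+y²), t)`. -/
def IsRadial (u : Hgrp → ℝ) : Prop :=
  ∃ U : ℝ × ℝ → ℝ, ∀ x y t : ℝ, u (x, y, t) = U (Real.sqrt (x ^ 2 + y ^ 2), t)

/-- Horizontal derivative `Xu = ∂u/∂x + 2y ∂u/∂t`. -/
def Xd (u : Hgrp → ℝ) (g : Hgrp) : ℝ :=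
  fderiv ℝ u g (1, 0, 0) + 2 * g.2.1 * fderiv ℝ u g (0, 0, 1)

/-- Horizontal derivative `Yu = ∂u/∂y − 2x ∂u/∂t`. -/
def Yd (u : Hgrp → ℝ) (g : Hgrp) : ℝ :=
  fderiv ℝ u g (0, 1, 0) - 2 * g.1 * fderiv ℝ u g (0, 0, 1)

/-- Difference quotient of `u` at `g` in the `X` direction. -/
def XdiffQuot (u : Hgrp → ℝ) (g : Hgrp) (l : ℝ) : ℝ := (u (hmul g (l, 0, 0)) - u g) / l

/-- Difference quotient of `u` at `g` in the `Y` direction. -/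
def YdiffQuot (u : Hgrp → ℝ) (g : Hgrp) (l : ℝ) : ℝ := (u (hmul g (0, l, 0)) - u g) / l

/-- Existence of the two-sided limit `Xu(g)`. -/
def XlimExists (u : Hgrp → ℝ) (g : Hgrp) : Prop :=
  ∃ a : ℝ, Filter.Tendsto (XdiffQuot u g) (nhdsWithin 0 {0}ᶜ) (nhds a)

/-- Existence of the two-sided limit `Yu(g)`. -/
def YlimExists (u : Hgrp → ℝ) (g : Hgrp) : Prop :=
  ∃ a : ℝ, Filter.Tendsto (YdiffQuot u g) (nhdsWithin 0 {0}ᶜ) (nhds a)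

/-- The value `Xu(g)` (defined via choice where the limit exists, else `0`). -/
def XuVal (u : Hgrp → ℝ) (g : Hgrp) : ℝ :=
  haveI := Classical.dec (XlimExists u g)
  if h : XlimExists u g then h.choose else 0

/-- The value `Yu(g)`. -/
def YuVal (u : Hgrp → ℝ) (g : Hgrp) : ℝ :=
  haveI := Classical.dec (YlimExists u g)
  if h : YlimExists u g then h.choose else 0

/-- The horizontal gradient `𝕏u(g) = (Xu(g), Yu(g))`. -/
def XXgrad (u : Hgrp → ℝ) (g : Hgrp) : ℝ × ℝ := (XuVal u g, YuVal u g)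

/-- The circle `C(t,R) = {(x,y,t) : x²+y² = R²}`. -/
def Ccirc (t R : ℝ) : Set Hgrp := {g | g.2.2 = t ∧ g.1 ^ 2 + g.2.1 ^ 2 = R ^ 2}

/-- A disc (open or closed) in `ℝ²` centered at the origin, of radius `R ∈ [0,∞]`. -/
def IsCenteredDisc (S : Set (ℝ × ℝ)) : Prop :=
  ∃ R : ℝ≥0∞, S = {p : ℝ × ℝ | ENNReal.ofReal (enorm2 p) < R} ∨
    S = {p : ℝ × ℝ | ENNReal.ofReal (enorm2 p) ≤ R}

/-- Diameter of a subset of `ℍ` with respect to the Korányi distance. -/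
def kdiam (S : Set Hgrp) : ℝ≥0∞ :=
  ⨆ a ∈ S, ⨆ b ∈ S, ENNReal.ofReal (kdist a b)

/-- The 2-dimensional Hausdorff (outer) measure of the metric space `(ℍ, ρ)`. -/
def kHaus2 (S : Set Hgrp) : ℝ≥0∞ :=
  ⨆ (ε : ℝ≥0∞) (_ : 0 < ε),
    ⨅ (c : ℕ → Set Hgrp) (_ : S ⊆ ⋃ n, c n) (_ : ∀ n, kdiam (c n) ≤ ε),
      ∑' n, (kdiam (c n)) ^ 2

/-- The set `D` of points of `Ω` where both horizontal derivatives exist. -/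
def Dset (Ω : Set Hgrp) (u : Hgrp → ℝ) : Set Hgrp :=
  {g ∈ Ω | XlimExists u g ∧ YlimExists u g}

/-- The level set `Σ^E_v = {g ∈ E ∩ D : 𝕏u(g) = v}`. -/
def SigmaSet (Ω : Set Hgrp) (u : Hgrp → ℝ) (E : Set Hgrp) (v : ℝ × ℝ) : Set Hgrp :=
  {g ∈ E ∩ Dset Ω u | XXgrad u g = v}

/-- The Monge–Ampère set function `ν_u(E) = ∫_{ℝ²} 𝓗²_ρ(Σ^E_v) dv`. -/
def nuMA (Ω : Set Hgrp) (u : Hgrp → ℝ) (E : Set Hgrp) : ℝ≥0∞ :=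
  ∫⁻ v : ℝ × ℝ, kHaus2 (SigmaSet Ω u E v)

/-- The restriction of `u` to a horizontal line through `g` is differentiable, with derivative
given by the horizontal derivatives of `u`. -/
theorem tendsto_slope_horizontal {u : Hgrp → ℝ} {g : Hgrp} (hu : DifferentiableAt ℝ u g)
    (a b : ℝ) :
    Tendsto (fun l : ℝ ↦ l⁻¹ * (u (g + l • (a, b, 2 * g.2.1 * a - 2 * g.1 * b)) - u g))
      (𝓝[>] 0) (𝓝 (a * Xd u g + b * Yd u g)) := by
  set w : Hgrp := (a, b, 2 * g.2.1 * a - 2 * g.1 * b) with hw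
  have hderiv : fderiv ℝ u g w = a * Xd u g + b * Yd u g := by
    have hsplit : w = a • ((1, 0, 0) : Hgrp) + b • ((0, 1, 0) : Hgrp)
        + (2 * g.2.1 * a - 2 * g.1 * b) • ((0, 0, 1) : Hgrp) := by
      simp [hw]
    rw [hsplit]
    simp only [map_add, map_smul, smul_eq_mul, Xd, Yd]
    ring
  have h := (hu.hasFDerivAt.hasLineDerivAt w).tendsto_slope_zero_right
  simpa [hderiv] using h

/-- A differentiable H-convex function has its horizontal gradient as its only H-subgradient. -/
theorem hsub_univ_eq_singleton {u : Hgrp → ℝ} {g : Hgrp} (hconv : HConvexOn univ u)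
    (hu : DifferentiableAt ℝ u g) : hsub univ u g = {(Xd u g, Yd u g)} := by
  apply Subset.antisymm
  · intro p hp
    have key (a b : ℝ) : a * p.1 + b * p.2 ≤ a * Xd u g + b * Yd u g := by
      refine ge_of_tendsto (tendsto_slope_horizontal hu a b) ?_
      filter_upwards [self_mem_nhdsWithin] with l (hl : 0 < l)
      have h := hp (g + l • (a, b, 2 * g.2.1 * a - 2 * g.1 * b)) ⟨by
        simp only [hplane, mem_ofPred_eq, Prod.fst_add, Prod.snd_add, Prod.smul_fst,
          Prod.smul_snd, smul_eq_mul]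
        ring, mem_univ _⟩
      simp only [dot, xi1, Prod.fst_add, Prod.snd_add, Prod.smul_fst, Prod.smul_snd,
        smul_eq_mul, Prod.fst_sub, Prod.snd_sub] at h
      rw [inv_mul_eq_div, le_div_iff₀ hl]
      linarith
    rw [mem_singleton_iff, Prod.ext_iff]
    constructor <;> linarith [key 1 0, key (-1) 0, key 0 1, key 0 (-1)]
  · rintro _ rfl g' ⟨hg', -⟩
    have hlim := tendsto_slope_horizontal hu (g'.1 - g.1) (g'.2.1 - g.2.1)
    have h := le_of_tendsto (b := u g' - u g) hlim <| by
      filter_upwards [Ioc_mem_nhdsGT one_pos] with l hl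
      have hc := hconv g (mem_univ _) g' ⟨hg', mem_univ _⟩ l ⟨hl.1.le, hl.2⟩
      have hpt : hmul g (hdil l (hmul (hinv g) g')) = g + l • (g'.1 - g.1, g'.2.1 - g.2.1,
          2 * g.2.1 * (g'.1 - g.1) - 2 * g.1 * (g'.2.1 - g.2.1)) := by
        simp only [hplane, mem_ofPred_eq] at hg'
        simp only [hmul, hdil, hinv, hg', Prod.ext_iff, Prod.fst_add, Prod.snd_add,
          Prod.smul_fst, Prod.smul_snd, smul_eq_mul]
        refine ⟨?_, ?_, ?_⟩ <;> ring
      rw [hpt] at hc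
      rw [inv_mul_eq_div, div_le_iff₀ hl.1]
      linarith
    simp only [dot, xi1, Prod.fst_sub, Prod.snd_sub]
    linarith

/-- The linear map of `ℝ²` with matrix `!![c, -s; s, c]`. -/
def rot (c s : ℝ) (p : ℝ × ℝ) : ℝ × ℝ := (c * p.1 - s * p.2, s * p.1 + c * p.2)

/-- The H-subdifferential of a radial function is equivariant under rotations. -/
theorem IsRadial.rot_mem_hsub {u : Hgrp → ℝ} (hrad : IsRadial u) {c s : ℝ}
    (hcs : c ^ 2 + s ^ 2 = 1) {x y t : ℝ} {p : ℝ × ℝ} (hp : p ∈ hsub univ u (x, y, t)) :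
    rot c s p ∈ hsub univ u (c * x - s * y, s * x + c * y, t) := by
  obtain ⟨U, hU⟩ := hrad
  have hinvariant (c s x y t : ℝ) (hcs : c ^ 2 + s ^ 2 = 1) :
      u (c * x - s * y, s * x + c * y, t) = u (x, y, t) := by
    rw [hU, hU]
    congr 3
    linear_combination (x ^ 2 + y ^ 2) * hcs
  rintro ⟨x', y', t'⟩ ⟨hg, -⟩
  simp only [hplane, mem_ofPred_eq] at hg
  have h := hp (c * x' + s * y', c * y' - s * x', t') ⟨by
    simp only [hplane, mem_ofPred_eq]
    linear_combination hg, mem_univ _⟩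
  have hback := hinvariant c (-s) x' y' t' (by linear_combination hcs)
  rw [show (c * x' - -s * y', -s * x' + c * y', t') = (c * x' + s * y', c * y' - s * x', t') by
    simp only [Prod.mk.injEq]
    refine ⟨?_, ?_, trivial⟩ <;> ring] at hback
  rw [hback] at h
  rw [hinvariant c s x y t hcs]
  simp only [dot, xi1, rot, Prod.fst_sub, Prod.snd_sub] at h ⊢
  refine h.le.trans_eq' ?_
  linear_combination (p.1 * x + p.2 * y) * hcs

/-- Rotations act transitively on centred circles. -/
theorem exists_rot_eq {p q : ℝ × ℝ} (h : p.1 ^ 2 + p.2 ^ 2 = q.1 ^ 2 + q.2 ^ 2) :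
    ∃ c s : ℝ, c ^ 2 + s ^ 2 = 1 ∧ rot c s p = q := by
  rcases eq_or_ne (p.1 ^ 2 + p.2 ^ 2) 0 with h0 | h0
  · refine ⟨1, 0, by norm_num, ?_⟩
    have h1 : q.1 ^ 2 + q.2 ^ 2 = 0 := h ▸ h0
    have hp1 : p.1 = 0 := by nlinarith
    have hp2 : p.2 = 0 := by nlinarith
    have hq1 : q.1 = 0 := by nlinarith
    have hq2 : q.2 = 0 := by nlinarith
    simp [rot, Prod.ext_iff, *]
  · refine ⟨(p.1 * q.1 + p.2 * q.2) / (p.1 ^ 2 + p.2 ^ 2),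
      (p.1 * q.2 - p.2 * q.1) / (p.1 ^ 2 + p.2 ^ 2), ?_, ?_⟩
    · field_simp
      linear_combination -(p.1 ^ 2 + p.2 ^ 2) * h
    · rw [rot, Prod.ext_iff]
      constructor <;> (field_simp; ring)

theorem enorm2_rot {c s : ℝ} (hcs : c ^ 2 + s ^ 2 = 1) (p : ℝ × ℝ) :
    enorm2 (rot c s p) = enorm2 p := by
  simp only [enorm2, rot]
  congr 1
  linear_combination (p.1 ^ 2 + p.2 ^ 2) * hcs

/-- the H-normal image of the circle `C(t,R)` under a radial, H-convex,
`C¹` function is a circle `{p : |p| = R'}` in `ℝ²`. -/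
theorem stmt12 (u : Hgrp → ℝ) (hrad : IsRadial u) (hconv : HConvexOn Set.univ u)
    (hu : ContDiff ℝ 1 u) (t R : ℝ) (hR : 0 ≤ R) :
    ∃ R' : ℝ, 0 ≤ R' ∧
      hsubSet Set.univ u (Ccirc t R) = {p : ℝ × ℝ | enorm2 p = R'} := by
  have hsingle (g : Hgrp) := hsub_univ_eq_singleton hconv (hu.differentiable one_ne_zero g)
  obtain ⟨p, hp⟩ : ∃ p, hsub univ u (R, 0, t) = {p} := ⟨_, hsingle _⟩
  have hmem : p ∈ hsub univ u (R, 0, t) := hp ▸ mem_singleton p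
  refine ⟨enorm2 p, Real.sqrt_nonneg _, Subset.antisymm ?_ ?_⟩
  · intro q hq
    obtain ⟨⟨x, y, t'⟩, ⟨ht, hxy⟩, hqg⟩ := mem_iUnion₂.1 hq
    dsimp only at ht hxy
    subst ht
    obtain ⟨c, s, hcs, hrot⟩ := exists_rot_eq (p := (R, 0)) (q := (x, y)) (by simp [hxy])
    have h := hrad.rot_mem_hsub hcs hmem
    rw [rot, Prod.mk.injEq] at hrot
    dsimp only at hrot
    rw [hrot.1, hrot.2, hsingle, mem_singleton_iff] at h
    rw [hsingle, mem_singleton_iff, ← h] at hqg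
    rw [mem_ofPred_eq, hqg, enorm2_rot hcs]
  · intro q hq
    obtain ⟨c, s, hcs, rfl⟩ := exists_rot_eq (p := p) (q := q)
      ((Real.sqrt_inj (by positivity) (by positivity)).1 hq.symm)
    refine mem_iUnion₂.2 ⟨_, ⟨rfl, ?_⟩, hrad.rot_mem_hsub hcs hmem⟩
    dsimp only
    linear_combination R ^ 2 * hcs
end
end

section
/- Let V be a real-valued C² function on an open subset D of (0,∞)×ℝ, let t ∈ ℝ, and let I ⊆ (0,∞) be an interval with I×{t} ⊆ D. If r³ V_{tr}(r,t)² − V_r(r,t) V_{rr}(r,t) < 0 for every r ∈ I, then the function r ↦ V_r(r,t)² + 4r² V_t(r,t)² is strictly increasing on I. -/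
noncomputable section

open Filter Topology Set
open scoped ENNReal

/-- if `r³ V_{tr}² − V_r V_{rr} < 0` on an interval `I`, then
`r ↦ V_r(r,t)² + 4r² V_t(r,t)²` is strictly increasing on `I`. -/
theorem stmt14 (V : ℝ × ℝ → ℝ) (D : Set (ℝ × ℝ)) (hD : IsOpen D)
    (hDsub : D ⊆ Set.Ioi (0:ℝ) ×ˢ (Set.univ : Set ℝ))
    (hV : ContDiffOn ℝ 2 V D) (t : ℝ) (I : Set ℝ) (hI : I.OrdConnected)
    (hIpos : I ⊆ Set.Ioi (0:ℝ)) (hID : ∀ r ∈ I, (r, t) ∈ D)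
    (hcond : ∀ r ∈ I,
      r ^ 3 * (fderiv ℝ (fun q : ℝ × ℝ => fderiv ℝ V q (0, 1)) (r, t) (1, 0)) ^ 2 -
        fderiv ℝ V (r, t) (1, 0) *
          fderiv ℝ (fun q : ℝ × ℝ => fderiv ℝ V q (1, 0)) (r, t) (1, 0) < 0) :
    StrictMonoOn (fun r : ℝ =>
      (fderiv ℝ V (r, t) (1, 0)) ^ 2 + 4 * r ^ 2 * (fderiv ℝ V (r, t) (0, 1)) ^ 2) I := by
  have hderiv : ∀ r ∈ I, ∀ v : ℝ × ℝ, HasDerivAt (fun s : ℝ => fderiv ℝ V (s, t) v)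
      (fderiv ℝ (fun q : ℝ × ℝ => fderiv ℝ V q v) (r, t) (1, 0)) r := by
    intro r hr v
    have hC : ContDiffAt ℝ 2 V (r, t) := hV.contDiffAt (hD.mem_nhds (hID r hr))
    have hd : DifferentiableAt ℝ (fderiv ℝ V) (r, t) :=
      (hC.fderiv_right (m := 1) (by norm_num)).differentiableAt (by norm_num)
    have hdv : DifferentiableAt ℝ (fun q : ℝ × ℝ => fderiv ℝ V q v) (r, t) :=
      hd.clm_apply (differentiableAt_const v)
    exact hdv.hasFDerivAt.comp_hasDerivAt r ((hasDerivAt_id r).prodMk (hasDerivAt_const r t))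
  have key := fun r hr => ((hderiv r hr (1, 0)).fun_pow 2).fun_add
    ((((hasDerivAt_id' r).fun_pow 2).const_mul 4).fun_mul ((hderiv r hr (0, 1)).fun_pow 2))
  refine strictMonoOn_of_deriv_pos hI.convex
    (fun r hr => (key r hr).continuousAt.continuousWithinAt) fun r hr => ?_
  have hrI := interior_subset hr
  have hr0 : 0 < r := hIpos hrI
  have hc := hcond r hrI
  rw [(key r hrI).deriv]
  have hsq := mul_nonneg hr0.le (sq_nonneg
    (r * fderiv ℝ (fun q : ℝ × ℝ => fderiv ℝ V q (0, 1)) (r, t) (1, 0)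
      + 2 * fderiv ℝ V (r, t) (0, 1)))
  norm_num
  linarith
end
end

section
/- Let u, v : ℍ → ℝ be radial and strictly H-convex, with u continuously differentiable and v twice continuously differentiable on ℝ³, u(g) ≤ v(g) for all g ∈ ℍ, the set Ω = {g : u(g) < 0} = {g : v(g) < 0} nonempty and bounded, and ∂Ω = {g : u(g) = 0} = {g : v(g) = 0}. Write v(x,y,t) = V(√(x²+y²), t), and assume that r³ V_{tr}(r,t)² − V_r(r,t) V_{rr}(r,t) < 0 for every (r,t) with r > 0 such that some point (r cos θ, r sin θ, t) lies in the closure of Ω. Then ∂_H v(Ω) ⊆ ∂_H u(Ω). -/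
noncomputable section

open Filter Topology Set
open scoped ENNReal

/-- The profile of a function on `ℍ` on the half plane `y = 0`. -/
def profile (w : Hgrp → ℝ) (q : ℝ × ℝ) : ℝ := w (q.1, 0, q.2)

lemma IsRadial.eq_of_sq_add_sq_eq {w : Hgrp → ℝ} (hw : IsRadial w) {x y x' y' : ℝ} (t : ℝ)
    (h : x ^ 2 + y ^ 2 = x' ^ 2 + y' ^ 2) : w (x, y, t) = w (x', y', t) := by
  obtain ⟨U, hU⟩ := hw
  rw [hU, hU, h]

lemma IsRadial.rotate_mem_hsub {w : Hgrp → ℝ} (hw : IsRadial w) {c s : ℝ}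
    (hcs : c ^ 2 + s ^ 2 = 1) {x y t : ℝ} {p : ℝ × ℝ} (hp : p ∈ hsub univ w (x, y, t)) :
    (c * p.1 - s * p.2, s * p.1 + c * p.2) ∈
      hsub univ w (c * x - s * y, s * x + c * y, t) := by
  rintro ⟨a, b, d⟩ ⟨hg, -⟩
  have hg' : d = t + 2 * (s * x + c * y) * a - 2 * (c * x - s * y) * b := hg
  have h := hp (c * a + s * b, -s * a + c * b, d) ⟨by
    change d = t + 2 * y * (c * a + s * b) - 2 * x * (-s * a + c * b)
    rw [hg']; ring, mem_univ _⟩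
  rw [hw.eq_of_sq_add_sq_eq (x' := a) (y' := b) d (by linear_combination (a ^ 2 + b ^ 2) * hcs),
    hw.eq_of_sq_add_sq_eq (x := x) (y := y) (x' := c * x - s * y) (y' := s * x + c * y) t
      (by linear_combination -(x ^ 2 + y ^ 2) * hcs)] at h
  simp only [dot, xi1, Prod.fst_sub, Prod.snd_sub] at h ⊢
  linear_combination h - (p.1 * x + p.2 * y) * hcs

lemma exists_rotation {a b : ℝ × ℝ} (h : a.1 ^ 2 + a.2 ^ 2 = b.1 ^ 2 + b.2 ^ 2) :
    ∃ c s : ℝ, c ^ 2 + s ^ 2 = 1 ∧ c * a.1 - s * a.2 = b.1 ∧ s * a.1 + c * a.2 = b.2 := by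
  by_cases ha : a.1 ^ 2 + a.2 ^ 2 = 0
  · have h1 : a.1 = 0 := by nlinarith [sq_nonneg a.1, sq_nonneg a.2]
    have h2 : a.2 = 0 := by nlinarith [sq_nonneg a.1, sq_nonneg a.2]
    have h3 : b.1 = 0 := by nlinarith [sq_nonneg b.1, sq_nonneg b.2]
    have h4 : b.2 = 0 := by nlinarith [sq_nonneg b.1, sq_nonneg b.2]
    exact ⟨1, 0, by norm_num, by simp [h1, h3], by simp [h2, h4]⟩
  · refine ⟨(a.1 * b.1 + a.2 * b.2) / (a.1 ^ 2 + a.2 ^ 2),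
      (a.1 * b.2 - a.2 * b.1) / (a.1 ^ 2 + a.2 ^ 2), ?_, ?_, ?_⟩
    · field_simp
      linear_combination -(a.1 ^ 2 + a.2 ^ 2) * h
    · field_simp
      ring
    · field_simp
      ring

lemma ContDiff.profile {n : WithTop ℕ∞} {w : Hgrp → ℝ} (hw : ContDiff ℝ n w) :
    ContDiff ℝ n (profile w) :=
  hw.comp (contDiff_fst.prodMk (contDiff_const.prodMk contDiff_snd))

lemma fderiv_profile {w : Hgrp → ℝ} (hw : Differentiable ℝ w) (q h : ℝ × ℝ) :
    fderiv ℝ (profile w) q h = fderiv ℝ w (q.1, 0, q.2) (h.1, 0, h.2) := by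
  have hL := (hasFDerivAt_fst (𝕜 := ℝ) (p := q)).prodMk
    ((hasFDerivAt_const (0 : ℝ) q).prodMk (hasFDerivAt_snd (𝕜 := ℝ) (p := q)))
  have := ((hw (q.1, 0, q.2)).hasFDerivAt.comp q hL).fderiv
  change fderiv ℝ (profile w) q = _ at this
  rw [this]
  rfl

lemma HasDerivAt.eq_zero_of_even {f : ℝ → ℝ} {f' : ℝ} (hf : HasDerivAt f f' 0)
    (he : ∀ x, f (-x) = f x) : f' = 0 := by
  have h := deriv_comp_neg f 0
  rw [funext he, neg_zero, hf.deriv] at h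
  linarith

lemma IsRadial.fderiv_apply {w : Hgrp → ℝ} (hr : IsRadial w) (hw : Differentiable ℝ w)
    (r t a b c : ℝ) :
    fderiv ℝ w (r, 0, t) (a, b, c) =
      a * fderiv ℝ (profile w) (r, t) (1, 0) + c * fderiv ℝ (profile w) (r, t) (0, 1) := by
  have hy : fderiv ℝ w (r, 0, t) (0, 1, 0) = 0 := by
    have hσ : HasDerivAt (fun y : ℝ => ((r, y, t) : Hgrp)) (0, 1, 0) 0 :=
      (hasDerivAt_const _ _).prodMk ((hasDerivAt_id _).prodMk (hasDerivAt_const _ _))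
    have hd : HasDerivAt (fun y : ℝ => w (r, y, t)) _ 0 :=
      (hw (r, 0, t)).hasFDerivAt.comp_hasDerivAt (0 : ℝ) hσ
    exact hd.eq_zero_of_even fun y => hr.eq_of_sq_add_sq_eq t (by ring)
  have hv : ((a, b, c) : Hgrp) =
      a • ((1, 0, 0) : Hgrp) + b • ((0, 1, 0) : Hgrp) + c • ((0, 0, 1) : Hgrp) := by
    simp
  rw [hv, map_add, map_add, map_smul, map_smul, map_smul, hy, fderiv_profile hw,
    fderiv_profile hw]
  simp

lemma IsRadial.fderiv_profile_zero {w : Hgrp → ℝ} (hr : IsRadial w) (hw : Differentiable ℝ w)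
    (t : ℝ) : fderiv ℝ (profile w) (0, t) (1, 0) = 0 := by
  have hσ : HasDerivAt (fun x : ℝ => ((x, 0, t) : Hgrp)) (1, 0, 0) 0 :=
    (hasDerivAt_id _).prodMk ((hasDerivAt_const _ _).prodMk (hasDerivAt_const _ _))
  have hd : HasDerivAt (fun x : ℝ => w (x, 0, t)) _ 0 :=
    (hw (0, 0, t)).hasFDerivAt.comp_hasDerivAt (0 : ℝ) hσ
  rw [fderiv_profile hw]
  exact hd.eq_zero_of_even fun x => hr.eq_of_sq_add_sq_eq t (by ring)

/-- The derivative of a radial function along the horizontal line through `(r, 0, t)` with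
direction `(a, b)`. -/
lemma IsRadial.hasDerivAt_horizontal {w : Hgrp → ℝ} (hr : IsRadial w) (hw : Differentiable ℝ w)
    (r t a b : ℝ) :
    HasDerivAt (fun l : ℝ => w (r + l * a, l * b, t - 2 * r * (l * b)))
      (a * fderiv ℝ (profile w) (r, t) (1, 0) +
        b * (-2 * r * fderiv ℝ (profile w) (r, t) (0, 1))) 0 := by
  have h1 : HasDerivAt (fun l : ℝ => r + l * a) a 0 := by
    simpa using ((hasDerivAt_id (0 : ℝ)).mul_const a).const_add r
  have h2 : HasDerivAt (fun l : ℝ => l * b) b 0 := by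
    simpa using (hasDerivAt_id (0 : ℝ)).mul_const b
  have h3 : HasDerivAt (fun l : ℝ => t - 2 * r * (l * b)) (-(2 * r * b)) 0 :=
    (h2.const_mul (2 * r)).const_sub t
  have hd := (hw (r + 0 * a, 0 * b, t - 2 * r * (0 * b))).hasFDerivAt.comp_hasDerivAt (0 : ℝ)
    (h1.prodMk (h2.prodMk h3))
  simp only [zero_mul, mul_zero, add_zero, sub_zero] at hd
  rw [hr.fderiv_apply hw] at hd
  exact hd.congr_deriv (by ring)

lemma IsRadial.eq_of_mem_hsub {w : Hgrp → ℝ} (hr : IsRadial w) (hw : Differentiable ℝ w)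
    {r t : ℝ} {p : ℝ × ℝ} (hp : p ∈ hsub univ w (r, 0, t)) :
    p = (fderiv ℝ (profile w) (r, t) (1, 0),
      -2 * r * fderiv ℝ (profile w) (r, t) (0, 1)) := by
  have key : ∀ a b : ℝ, a * fderiv ℝ (profile w) (r, t) (1, 0) +
      b * (-2 * r * fderiv ℝ (profile w) (r, t) (0, 1)) = p.1 * a + p.2 * b := by
    intro a b
    have hd := (hr.hasDerivAt_horizontal hw r t a b).sub
      ((hasDerivAt_id (0 : ℝ)).mul_const (p.1 * a + p.2 * b))
    have hmin : IsLocalMin ((fun l : ℝ => w (r + l * a, l * b, t - 2 * r * (l * b))) -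
        fun l : ℝ => id l * (p.1 * a + p.2 * b)) 0 := by
      refine Eventually.of_forall fun l => ?_
      have h := hp (r + l * a, l * b, t - 2 * r * (l * b)) ⟨by
        change t - 2 * r * (l * b) = t + 2 * 0 * (r + l * a) - 2 * r * (l * b)
        ring, mem_univ _⟩
      simp only [dot, xi1, Prod.fst_sub, Prod.snd_sub] at h
      simp only [Pi.sub_apply, id, zero_mul, mul_zero, add_zero, sub_zero]
      linarith
    linarith [hmin.hasDerivAt_eq_zero hd]
  ext
  · simpa using (key 1 0).symm
  · simpa using (key 0 1).symm

lemma HConvexOn.horizontal_le {w : Hgrp → ℝ} (hc : HConvexOn univ w) (r t a b : ℝ) {l : ℝ}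
    (hl : l ∈ Icc (0 : ℝ) 1) :
    w (r + l * a, l * b, t - 2 * r * (l * b)) ≤
      w (r, 0, t) + l * (w (r + a, b, t - 2 * r * b) - w (r, 0, t)) := by
  have h := hc (r, 0, t) (mem_univ _) (r + a, b, t - 2 * r * b) ⟨by
    change t - 2 * r * b = t + 2 * 0 * (r + a) - 2 * r * b
    ring, mem_univ _⟩ l hl
  convert h using 2
  simp only [hmul, hdil, hinv, Prod.mk.injEq]
  refine ⟨?_, ?_, ?_⟩ <;> ring

lemma IsRadial.mem_hsub {w : Hgrp → ℝ} (hr : IsRadial w) (hw : Differentiable ℝ w)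
    (hc : HConvexOn univ w) (r t : ℝ) :
    (fderiv ℝ (profile w) (r, t) (1, 0), -2 * r * fderiv ℝ (profile w) (r, t) (0, 1)) ∈
      hsub univ w (r, 0, t) := by
  rintro ⟨x, y, d⟩ ⟨hg, -⟩
  have hd : d = t + 2 * 0 * x - 2 * r * y := hg
  obtain rfl : d = t - 2 * r * y := by rw [hd]; ring
  have hslope := hasDerivWithinAt_iff_tendsto_slope.1
    ((hr.hasDerivAt_horizontal hw r t (x - r) y).hasDerivWithinAt (s := Ioi (0 : ℝ)))
  rw [sdiff_singleton_eq_self self_notMem_Ioi] at hslope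
  have hle := le_of_tendsto hslope (b := w (x, y, t - 2 * r * y) - w (r, 0, t)) (by
    filter_upwards [Ioc_mem_nhdsGT (zero_lt_one (α := ℝ))] with l hl
    have h := hc.horizontal_le r t (x - r) y ⟨hl.1.le, hl.2⟩
    rw [add_sub_cancel] at h
    rw [slope_def_field, div_le_iff₀ (by linarith [hl.1])]
    simp only [zero_mul, mul_zero, add_zero, sub_zero]
    linarith)
  simp only [dot, xi1, Prod.fst_sub, Prod.snd_sub]
  linarith

lemma fderiv_profile_eq_of_le {u v : Hgrp → ℝ} (hu : Differentiable ℝ u)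
    (hv : Differentiable ℝ v) (huv : ∀ g, u g ≤ v g) {r t : ℝ}
    (h : u (r, 0, t) = v (r, 0, t)) :
    fderiv ℝ (profile u) (r, t) = fderiv ℝ (profile v) (r, t) := by
  have hmin : IsLocalMin (v - u) (r, 0, t) := by
    refine Eventually.of_forall fun g => ?_
    simp only [Pi.sub_apply]
    linarith [huv g]
  have h0 := hmin.fderiv_eq_zero
  rw [fderiv_sub (hv _) (hu _), sub_eq_zero] at h0
  ext <;> simp [fderiv_profile hu, fderiv_profile hv, h0]

/-- Squared length of the horizontal gradient at `(r, 0, t)`, in terms of the profile. -/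
def gradSq (w : Hgrp → ℝ) (t r : ℝ) : ℝ :=
  fderiv ℝ (profile w) (r, t) (1, 0) ^ 2 +
    (-2 * r * fderiv ℝ (profile w) (r, t) (0, 1)) ^ 2

lemma continuous_gradSq {w : Hgrp → ℝ} (hw : ContDiff ℝ 1 w) (t : ℝ) :
    Continuous (gradSq w t) := by
  have hc : Continuous fun r : ℝ => fderiv ℝ (profile w) (r, t) :=
    (hw.profile.continuous_fderiv one_ne_zero).comp (by fun_prop)
  have h1 := hc.clm_apply (continuous_const (y := ((1, 0) : ℝ × ℝ)))
  have h2 := hc.clm_apply (continuous_const (y := ((0, 1) : ℝ × ℝ)))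
  exact (h1.pow 2).add (((continuous_const.mul continuous_id).mul h2).pow 2)

lemma hasDerivAt_fderiv_profile {w : Hgrp → ℝ} (hw : ContDiff ℝ 2 w) (r t : ℝ) (e : ℝ × ℝ) :
    HasDerivAt (fun s : ℝ => fderiv ℝ (profile w) (s, t) e)
      (fderiv ℝ (fun q : ℝ × ℝ => fderiv ℝ (profile w) q e) (r, t) (1, 0)) r := by
  have hd : Differentiable ℝ fun q : ℝ × ℝ => fderiv ℝ (profile w) q e :=
    ((hw.profile.fderiv_right (m := 1) (by norm_num)).clm_apply contDiff_const).differentiable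
      one_ne_zero
  exact (hd (r, t)).hasFDerivAt.comp_hasDerivAt r
    ((hasDerivAt_id r).prodMk (hasDerivAt_const r t))

lemma deriv_gradSq_pos {w : Hgrp → ℝ} (hw : ContDiff ℝ 2 w) {r t : ℝ} (hr : 0 < r)
    (h : r ^ 3 * (fderiv ℝ (fun q : ℝ × ℝ => fderiv ℝ (profile w) q (0, 1)) (r, t) (1, 0)) ^ 2 -
        fderiv ℝ (profile w) (r, t) (1, 0) *
          fderiv ℝ (fun q : ℝ × ℝ => fderiv ℝ (profile w) q (1, 0)) (r, t) (1, 0) < 0) :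
    0 < deriv (gradSq w t) r := by
  have h1 := hasDerivAt_fderiv_profile hw r t (1, 0)
  have h2 := hasDerivAt_fderiv_profile hw r t (0, 1)
  have h3 := (h1.pow 2).add ((((hasDerivAt_id r).const_mul (-2)).mul h2).pow 2)
  change HasDerivAt (gradSq w t) _ r at h3
  rw [h3.deriv]
  simp only [id, Nat.cast_ofNat, Nat.add_one_sub_one, pow_one, mul_one, Pi.mul_apply]
  set A := fderiv ℝ (profile w) (r, t) (1, 0)
  set B := fderiv ℝ (profile w) (r, t) (0, 1)
  set C := fderiv ℝ (fun q : ℝ × ℝ => fderiv ℝ (profile w) q (1, 0)) (r, t) (1, 0)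
  set D := fderiv ℝ (fun q : ℝ × ℝ => fderiv ℝ (profile w) q (0, 1)) (r, t) (1, 0)
  nlinarith [mul_nonneg hr.le (sq_nonneg (r * D + 2 * B))]

/-- under the hypotheses of the monotonicity theorem, together with the
radial profile condition `r³ V_{tr}² − V_r V_{rr} < 0` on the closure of `Ω`, one has
`∂_H v(Ω) ⊆ ∂_H u(Ω)`. -/
theorem stmt16 (u v : Hgrp → ℝ) (V : ℝ × ℝ → ℝ)
    (hur : IsRadial u)
    (hvrad : ∀ x y t : ℝ, v (x, y, t) = V (Real.sqrt (x ^ 2 + y ^ 2), t))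
    (hus : StrictHConvexOn u) (hvs : StrictHConvexOn v)
    (huC : ContDiff ℝ 1 u) (hvC : ContDiff ℝ 2 v)
    (huv : ∀ g, u g ≤ v g)
    (hEq : {g : Hgrp | u g < 0} = {g : Hgrp | v g < 0})
    (hne : {g : Hgrp | u g < 0}.Nonempty)
    (hbdd : Bornology.IsBounded {g : Hgrp | u g < 0})
    (hfr1 : frontier {g : Hgrp | u g < 0} = {g : Hgrp | u g = 0})
    (hfr2 : frontier {g : Hgrp | u g < 0} = {g : Hgrp | v g = 0})
    (hcond : ∀ r t : ℝ, 0 < r →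
      (∃ θ : ℝ, ((r * Real.cos θ, r * Real.sin θ, t) : Hgrp) ∈
        closure {g : Hgrp | u g < 0}) →
      r ^ 3 * (fderiv ℝ (fun q : ℝ × ℝ => fderiv ℝ V q (0, 1)) (r, t) (1, 0)) ^ 2 -
        fderiv ℝ V (r, t) (1, 0) *
          fderiv ℝ (fun q : ℝ × ℝ => fderiv ℝ V q (1, 0)) (r, t) (1, 0) < 0) :
    hsubSet Set.univ v {g : Hgrp | u g < 0} ⊆
      hsubSet Set.univ u {g : Hgrp | u g < 0} := by
  have hvr : IsRadial v := ⟨V, hvrad⟩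
  have hud : Differentiable ℝ u := huC.differentiable one_ne_zero
  have hvC1 : ContDiff ℝ 1 v := hvC.of_le (by norm_num)
  have hvd : Differentiable ℝ v := hvC1.differentiable one_ne_zero
  intro p hp
  simp only [hsubSet, mem_iUnion, exists_prop] at hp ⊢
  obtain ⟨⟨x, y, t⟩, hg, hp⟩ := hp
  obtain ⟨r, hr, hrxy⟩ : ∃ r : ℝ, 0 ≤ r ∧ x ^ 2 + y ^ 2 = r ^ 2 :=
    ⟨√(x ^ 2 + y ^ 2), Real.sqrt_nonneg _, (Real.sq_sqrt (by positivity)).symm⟩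
  have hur0 : u (r, 0, t) < 0 := by
    rw [hur.eq_of_sq_add_sq_eq t (x' := x) (y' := y) (by linarith)]
    exact hg
  -- rotate the base point onto the half plane `y = 0`
  have hN : p.1 ^ 2 + p.2 ^ 2 = gradSq v t r := by
    obtain ⟨c, s, hcs, h1, h2⟩ := exists_rotation (a := (x, y)) (b := (r, 0)) (by simpa using hrxy)
    have h := hvr.rotate_mem_hsub hcs hp
    simp only at h1 h2
    rw [h1, h2] at h
    have he := hvr.eq_of_mem_hsub hvd h
    rw [Prod.mk.injEq] at he
    rw [gradSq, ← he.1, ← he.2]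
    linear_combination -(p.1 ^ 2 + p.2 ^ 2) * hcs
  have hu0 : u (0, 0, t) < 0 := by
    have h := hus.1.horizontal_le r t (-2 * r) 0 (l := 1 / 2) (by norm_num)
    rw [show r + 1 / 2 * (-2 * r) = 0 by ring, show r + -2 * r = -r by ring] at h
    simp only [mul_zero, sub_zero] at h
    rw [hur.eq_of_sq_add_sq_eq t (x := -r) (y := 0) (x' := r) (y' := 0) (by ring)] at h
    linarith
  obtain ⟨R, hR, huR⟩ : ∃ R, r ≤ R ∧ 0 ≤ u (R, 0, t) := by
    obtain ⟨M, hM⟩ := hbdd.exists_norm_le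
    refine ⟨max r (M + 1), le_max_left _ _, ?_⟩
    by_contra! hlt
    have h := (norm_fst_le _).trans (hM _ hlt)
    exact absurd ((le_max_right r (M + 1)).trans ((le_abs_self _).trans h)) (by linarith)
  have hucont : Continuous fun s : ℝ => u (s, 0, t) := huC.continuous.comp (by fun_prop)
  obtain ⟨r₁, hr₁, hur₁⟩ := intermediate_value_Icc hR hucont.continuousOn ⟨hur0.le, huR⟩
  simp only at hur₁
  have hlt : r < r₁ := lt_of_le_of_ne hr₁.1 fun h => by rw [h] at hur0; linarith
  have hr₁0 : 0 < r₁ := hr.trans_lt hlt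
  have hneg : ∀ s, 0 ≤ s → s < r₁ → u (s, 0, t) < 0 := by
    intro s hs hs₁
    have hl : s / r₁ < 1 := (div_lt_one hr₁0).2 hs₁
    have h := hus.1.horizontal_le 0 t r₁ 0 (l := s / r₁) ⟨by positivity, hl.le⟩
    rw [div_mul_cancel₀ _ hr₁0.ne'] at h
    simp only [mul_zero, sub_zero, zero_add, hur₁, zero_sub] at h
    nlinarith
  have hvr₁ : v (r₁, 0, t) = 0 := by
    have h : ((r₁, 0, t) : Hgrp) ∈ {g : Hgrp | v g = 0} := by
      rw [← hfr2, hfr1]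
      exact hur₁
    exact h
  have hmono : StrictMonoOn (gradSq v t) (Icc r r₁) := by
    refine strictMonoOn_of_deriv_pos (convex_Icc _ _) (continuous_gradSq hvC1 t).continuousOn ?_
    intro s hs
    rw [interior_Icc] at hs
    have hs0 : 0 < s := hr.trans_lt hs.1
    refine deriv_gradSq_pos hvC hs0 ?_
    have hV : V =ᶠ[𝓝 (s, t)] profile v := by
      filter_upwards [continuous_fst.continuousAt.eventually (lt_mem_nhds hs0)] with q hq
      rw [profile, hvrad, zero_pow two_ne_zero, add_zero, Real.sqrt_sq hq.le]
    have hfV := hV.fderiv (𝕜 := ℝ)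
    have hfe : ∀ e : ℝ × ℝ, (fun q => fderiv ℝ V q e) =ᶠ[𝓝 (s, t)]
        fun q => fderiv ℝ (profile v) q e := fun e => hfV.mono fun q hq => by simp only [hq]
    have h := hcond s t hs0 ⟨0, subset_closure (by simpa using hneg s hs0.le hs.2)⟩
    rwa [(hfe (0, 1)).fderiv_eq, (hfe (1, 0)).fderiv_eq, hfV.self_of_nhds] at h
  have hgt : gradSq v t r < gradSq u t r₁ := by
    have h := hmono (left_mem_Icc.2 hlt.le) (right_mem_Icc.2 hlt.le) hlt
    rwa [gradSq, gradSq,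
      ← fderiv_profile_eq_of_le hud hvd huv (hur₁.trans hvr₁.symm), ← gradSq, ← gradSq] at h
  have hzero : gradSq u t 0 = 0 := by
    simp [gradSq, hur.fderiv_profile_zero hud]
  obtain ⟨s, hs, hsN⟩ := intermediate_value_Icc hr₁0.le (continuous_gradSq huC t).continuousOn
    (show gradSq v t r ∈ Icc (gradSq u t 0) (gradSq u t r₁) from
      ⟨by rw [hzero, ← hN]; positivity, hgt.le⟩)
  have hs₁ : s < r₁ := lt_of_le_of_ne hs.2 fun h => by rw [h] at hsN; linarith
  obtain ⟨c, d, hcd, h1, h2⟩ := exists_rotation (b := p)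
    (a := (fderiv ℝ (profile u) (s, t) (1, 0), -2 * s * fderiv ℝ (profile u) (s, t) (0, 1)))
    (hsN.trans hN.symm)
  have hmem := hur.rotate_mem_hsub hcd (hur.mem_hsub hud hus.1 s t)
  rw [h1, h2] at hmem
  refine ⟨_, ?_, hmem⟩
  change u (_, _, _) < 0
  rw [hur.eq_of_sq_add_sq_eq t (x' := s) (y' := 0) (by linear_combination s ^ 2 * hcd)]
  exact hneg s hs.1 hs₁
end
end

section
/- Let u : ℍ → ℝ be H-convex and let g₀, g ∈ ℍ. Then u(g) = u(g₀) + sup over all n ≥ 1 and all finite sequences (h₀, p₀), (h₁, p₁), …, (hₙ, pₙ) with h₀ = g₀, hₙ = g, h_{i+1} ∈ H_{h_i} for 0 ≤ i ≤ n−1, and p_i ∈ ∂_H u(h_i) for each i, of the sum Σ_{i=0}^{n−1} ⟨p_i, ξ₁(h_{i+1}) − ξ₁(h_i)⟩. -/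
noncomputable section

open Filter Topology Set
open scoped ENNReal

/-! ### Horizontal segments and left translations -/

lemma dot_smul_right (c : ℝ) (p q : ℝ × ℝ) : dot p (c • q) = c * dot p q := by
  simp only [dot, Prod.smul_fst, Prod.smul_snd, smul_eq_mul]; ring

lemma dot_sub_left (p p' q : ℝ × ℝ) : dot (p - p') q = dot p q - dot p' q := by
  simp only [dot, Prod.fst_sub, Prod.snd_sub]; ring

lemma hmul_hexp_mem_hplane (g : Hgrp) (v : ℝ × ℝ) : hmul g (hexp v) ∈ hplane g := by
  simp only [hplane, hmul, hexp, mem_ofPred_eq]; ring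

lemma zero_hmul (g : Hgrp) : hmul 0 g = g := by
  simp [hmul]

lemma hexp_zero : hexp 0 = 0 := rfl

lemma mem_hplane_self (g : Hgrp) : g ∈ hplane g := by
  simp only [hplane, mem_ofPred_eq]; ring

lemma hmul_hinv_cancel_left (a b : Hgrp) : hmul a (hmul (hinv a) b) = b := by
  ext <;> simp only [hmul, hinv] <;> ring

lemma continuous_hmul : Continuous fun q : Hgrp × Hgrp => hmul q.1 q.2 := by
  unfold hmul; fun_prop

/-- Horizontal segments are Euclidean segments, and any two of their points are mutually
horizontal. -/
lemma segment_mem_hplane {A B : Hgrp} (h : B ∈ hplane A) (r s : ℝ) :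
    A + s • (B - A) ∈ hplane (A + r • (B - A)) := by
  simp only [hplane, mem_ofPred_eq, Prod.fst_add, Prod.snd_add, Prod.smul_fst, Prod.smul_snd,
    Prod.fst_sub, Prod.snd_sub, smul_eq_mul] at h ⊢
  rw [h]; ring

namespace HConvexOn

variable {u : Hgrp → ℝ}

lemma segment_le (hu : HConvexOn univ u) {A B : Hgrp} (h : B ∈ hplane A) {l : ℝ}
    (hl : l ∈ Icc (0 : ℝ) 1) : u (A + l • (B - A)) ≤ u A + l * (u B - u A) := by
  have key := hu A trivial B ⟨h, trivial⟩ l hl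
  have e : hmul A (hdil l (hmul (hinv A) B)) = A + l • (B - A) := by
    simp only [hplane, mem_ofPred_eq] at h
    ext <;> simp only [hmul, hdil, hinv, Prod.fst_add, Prod.snd_add, Prod.smul_fst,
      Prod.smul_snd, Prod.fst_sub, Prod.snd_sub, smul_eq_mul]
    · ring
    · ring
    · rw [h]; ring
  rwa [e] at key

lemma le_of_mem_segment (hu : HConvexOn univ u) {A B C : Hgrp} {M l : ℝ} (hA : u A ≤ M)
    (hB : u B ≤ M) (h : B ∈ hplane A) (hl : l ∈ Icc (0 : ℝ) 1) (hC : A + l • (B - A) = C) :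
    u C ≤ M := by
  have := hu.segment_le h hl
  rw [hC] at this
  nlinarith [hl.1, hl.2]

lemma comp_hmul (hu : HConvexOn univ u) (k : Hgrp) : HConvexOn univ fun g => u (hmul k g) := by
  intro g _ g' hg' l hl
  have h' : hmul k g' ∈ hplane (hmul k g) := by
    have := hg'.1
    simp only [hplane, mem_ofPred_eq, hmul] at this ⊢
    rw [this]; ring
  have key := hu (hmul k g) trivial (hmul k g') ⟨h', trivial⟩ l hl
  convert key using 2
  ext <;> simp only [hmul, hdil, hinv] <;> ring

/-! ### Local boundedness from above -/

/-- The vertical segment over the origin lies in the H-convex hull of the vertices of a closed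
horizontal quadrilateral. -/
lemma exists_le_vertical_zero (hu : HConvexOn univ u) (T : ℝ) :
    ∃ M, ∀ t, |t| ≤ T → u (0, 0, t) ≤ M := by
  set c : ℝ := |T| + 1 with hc
  have c1 : 1 ≤ c := by linarith [abs_nonneg T]
  refine ⟨max (max (u (c, c, -2 * c ^ 2)) (u (c, -c, 2 * c ^ 2)))
    (max (u (-c, -c, -2 * c ^ 2)) (u (-c, c, 2 * c ^ 2))), fun t ht => ?_⟩
  have hT : |t| ≤ 2 * c ^ 2 := by nlinarith [le_abs_self T]
  have hl : t / (4 * c ^ 2) + 1 / 2 ∈ Icc (0 : ℝ) 1 := by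
    have h1 := abs_le.1 hT
    have h2 : t / (4 * c ^ 2) ≤ 1 / 2 := by
      rw [div_le_iff₀ (by positivity)]; linarith
    have h3 : -(1 / 2) ≤ t / (4 * c ^ 2) := by
      rw [le_div_iff₀ (by positivity)]; linarith
    constructor <;> linarith
  have hA : u (c, -(t / (2 * c)), t) ≤ _ :=
    hu.le_of_mem_segment (A := (c, c, -2 * c ^ 2)) (B := (c, -c, 2 * c ^ 2))
      (le_max_left _ _) (le_max_right _ _)
      (by simp only [hplane, mem_ofPred_eq]; ring) hl
      (by ext <;> simp <;> field_simp <;> ring)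
  have hB : u (-c, t / (2 * c), t) ≤ _ :=
    hu.le_of_mem_segment (A := (-c, -c, -2 * c ^ 2)) (B := (-c, c, 2 * c ^ 2))
      (le_max_left _ _) (le_max_right _ _)
      (by simp only [hplane, mem_ofPred_eq]; ring) hl
      (by ext <;> simp <;> field_simp <;> ring)
  exact hu.le_of_mem_segment (l := 1 / 2) (hA.trans (le_max_left _ _))
    (hB.trans (le_max_right _ _)) (by simp only [hplane, mem_ofPred_eq]; field_simp; ring)
    (by norm_num) (by ext <;> simp <;> ring)

lemma exists_le_vertical (hu : HConvexOn univ u) (x y T : ℝ) :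
    ∃ M, ∀ t, |t| ≤ T → u (x, y, t) ≤ M := by
  obtain ⟨M, hM⟩ := (hu.comp_hmul (x, y, 0)).exists_le_vertical_zero T
  exact ⟨M, fun t ht => by simpa [hmul] using hM t ht⟩

lemma exists_le_box (hu : HConvexOn univ u) {R : ℝ} (hR : 0 < R) :
    ∃ M, ∀ x y t, |x| ≤ R → |y| ≤ R → |t| ≤ R → u (x, y, t) ≤ M := by
  have side : ∀ a, |a| = R → ∃ M, ∀ y t, |y| ≤ R → |t| ≤ R + 4 * R ^ 2 → u (a, y, t) ≤ M := by
    intro a ha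
    obtain ⟨M₁, h₁⟩ := hu.exists_le_vertical a R (R + 8 * R ^ 2)
    obtain ⟨M₂, h₂⟩ := hu.exists_le_vertical a (-R) (R + 8 * R ^ 2)
    refine ⟨max M₁ M₂, fun y t hy ht => ?_⟩
    have hy' := abs_le.1 hy
    have bound : ∀ b, |b| ≤ R → |t + 2 * a * (y - b)| ≤ R + 8 * R ^ 2 := by
      intro b hb
      have h1 : |y - b| ≤ R + R := (abs_sub y b).trans (add_le_add hy hb)
      calc |t + 2 * a * (y - b)| ≤ |t| + |2 * a * (y - b)| := abs_add_le _ _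
        _ = |t| + 2 * R * |y - b| := by rw [abs_mul, abs_mul, ha]; norm_num
        _ ≤ R + 8 * R ^ 2 := by nlinarith
    refine hu.le_of_mem_segment (l := (R - y) / (2 * R))
      ((h₁ _ (bound R (abs_of_pos hR).le)).trans (le_max_left _ _))
      ((h₂ _ (bound (-R) (by rw [abs_neg, abs_of_pos hR]))).trans (le_max_right _ _))
      (by simp only [hplane, mem_ofPred_eq]; ring) ⟨?_, ?_⟩
      (by ext <;> simp <;> field_simp <;> ring)
    · exact div_nonneg (by linarith) (by linarith)
    · rw [div_le_one (by linarith)]; linarith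
  obtain ⟨M₁, h₁⟩ := side R (abs_of_pos hR)
  obtain ⟨M₂, h₂⟩ := side (-R) (by rw [abs_neg, abs_of_pos hR])
  refine ⟨max M₁ M₂, fun x y t hx hy ht => ?_⟩
  have hx' := abs_le.1 hx
  have bound : ∀ b, |b| ≤ R → |t + 2 * y * (b - x)| ≤ R + 4 * R ^ 2 := by
    intro b hb
    have h1 : |b - x| ≤ R + R := (abs_sub b x).trans (add_le_add hb hx)
    calc |t + 2 * y * (b - x)| ≤ |t| + |2 * y * (b - x)| := abs_add_le _ _
      _ = |t| + 2 * (|y| * |b - x|) := by rw [abs_mul, abs_mul]; norm_num; ring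
      _ ≤ R + 2 * (R * (R + R)) := by gcongr
      _ = R + 4 * R ^ 2 := by ring
  refine hu.le_of_mem_segment (l := (R - x) / (2 * R))
    ((h₁ y _ hy (bound R (abs_of_pos hR).le)).trans (le_max_left _ _))
    ((h₂ y _ hy (bound (-R) (by rw [abs_neg, abs_of_pos hR]))).trans (le_max_right _ _))
    (by simp only [hplane, mem_ofPred_eq]; ring) ⟨?_, ?_⟩
    (by ext <;> simp <;> field_simp <;> ring)
  · exact div_nonneg (by linarith) (by linarith)
  · rw [div_le_one (by linarith)]; linarith

/-! ### Continuity -/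

lemma harnack_of_nonneg (hu : HConvexOn univ u) {g : Hgrp} {v : ℝ × ℝ} {M r : ℝ}
    (h₁ : u (hmul g (hexp v)) ≤ M) (h₂ : u (hmul g (hexp (-v))) ≤ M) (hr : r ∈ Icc (0 : ℝ) 1) :
    (1 - r) * (M - u g) ≤ M - u (hmul g (hexp (r • v))) ∧
      M - u (hmul g (hexp (r • v))) ≤ (1 + r) * (M - u g) := by
  obtain ⟨hr0, hr1⟩ := hr
  have hpos : 0 < 1 + r := by linarith
  constructor
  · have key := hu.segment_le (hmul_hexp_mem_hplane g v) ⟨hr0, hr1⟩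
    have e : g + r • (hmul g (hexp v) - g) = hmul g (hexp (r • v)) := by
      ext <;> simp [hmul, hexp]
      ring
    rw [e] at key
    nlinarith
  · have hl : r / (1 + r) ∈ Icc (0 : ℝ) 1 :=
      ⟨by positivity, by rw [div_le_one hpos]; linarith⟩
    have hmem : hmul g (hexp (-v)) ∈ hplane (hmul g (hexp (r • v))) := by
      simp [hplane, hmul, hexp]; ring
    have key := hu.segment_le hmem hl
    have e : hmul g (hexp (r • v)) + (r / (1 + r)) • (hmul g (hexp (-v)) -
        hmul g (hexp (r • v))) = g := by
      ext <;> simp [hmul, hexp] <;> field_simp <;> ring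
    rw [e] at key
    have h3 : (1 + r) * u g ≤ u (hmul g (hexp (r • v))) + r * u (hmul g (hexp (-v))) := by
      calc (1 + r) * u g ≤ (1 + r) * (u (hmul g (hexp (r • v))) + r / (1 + r) *
            (u (hmul g (hexp (-v))) - u (hmul g (hexp (r • v))))) := by gcongr
        _ = _ := by field_simp; ring
    nlinarith

/-- A Harnack inequality for `M - u` along a horizontal segment around which `u ≤ M`. -/
lemma harnack (hu : HConvexOn univ u) {g : Hgrp} {v : ℝ × ℝ} {M r : ℝ}
    (h₁ : u (hmul g (hexp v)) ≤ M) (h₂ : u (hmul g (hexp (-v))) ≤ M) (hr : |r| ≤ 1) :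
    (1 - |r|) * (M - u g) ≤ M - u (hmul g (hexp (r • v))) ∧
      M - u (hmul g (hexp (r • v))) ≤ (1 + |r|) * (M - u g) := by
  rcases le_total 0 r with h | h
  · rw [abs_of_nonneg h] at hr ⊢
    exact hu.harnack_of_nonneg h₁ h₂ ⟨h, hr⟩
  · rw [abs_of_nonpos h] at hr ⊢
    have := hu.harnack_of_nonneg (v := -v) h₂ (by rwa [neg_neg]) ⟨neg_nonneg.2 h, hr⟩
    rwa [smul_neg, neg_smul, neg_neg] at this

end HConvexOn

/-- The endpoint of the horizontal chain which moves by `x` and `y` along the axes and then runs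
through the commutator of the axis moves `a` and `b`. -/
lemma axis_chain (g : Hgrp) (x y a b : ℝ) :
    hmul (hmul (hmul (hmul (hmul (hmul g (hexp (x, 0))) (hexp (0, y))) (hexp (a, 0)))
      (hexp (0, b))) (hexp (-a, 0))) (hexp (0, -b)) = hmul g (x, y, -2 * x * y - 4 * a * b) := by
  ext <;> simp [hmul, hexp]
  ring

lemma sqrt_sq_sub_sqrt_neg_sq (τ : ℝ) : √τ ^ 2 - √(-τ) ^ 2 = τ := by
  rcases le_total 0 τ with h | h
  · rw [Real.sq_sqrt h, Real.sqrt_eq_zero_of_nonpos (neg_nonpos.2 h)]; ring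
  · rw [Real.sq_sqrt (neg_nonneg.2 h), Real.sqrt_eq_zero_of_nonpos h]; ring

namespace HConvexOn

variable {u : Hgrp → ℝ}

/-- `u` tends to `u 0` along points tending to `0`, and this property is preserved by small
horizontal moves. -/
lemma tendsto_hmul_hexp (hu : HConvexOn univ u) {ι : Type*} {F : Filter ι} {G : ι → Hgrp}
    {r : ι → ℝ} (v : ℝ × ℝ) (h : Tendsto G F (𝓝 0) ∧ Tendsto (fun i => u (G i)) F (𝓝 (u 0)))
    (hr : Tendsto r F (𝓝 0)) :
    Tendsto (fun i => hmul (G i) (hexp (r i • v))) F (𝓝 0) ∧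
      Tendsto (fun i => u (hmul (G i) (hexp (r i • v)))) F (𝓝 (u 0)) := by
  obtain ⟨hG, huG⟩ := h
  have hmv : ∀ w : ℝ × ℝ, Tendsto (fun i => hmul (G i) (hexp w)) F (𝓝 (hexp w)) := fun w => by
    have := (continuous_hmul.tendsto (0, hexp w)).comp (hG.prodMk_nhds tendsto_const_nhds)
    simpa only [Function.comp_def, zero_hmul] using this
  have hexp_cont : Continuous fun q : Hgrp × ℝ => hexp (q.2 • v) := by
    simp only [hexp, Prod.smul_fst, Prod.smul_snd]; fun_prop
  have hcont : Continuous fun q : Hgrp × ℝ => hmul q.1 (hexp (q.2 • v)) :=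
    continuous_hmul.comp (continuous_fst.prodMk hexp_cont)
  constructor
  · have := (hcont.tendsto (0, 0)).comp (hG.prodMk_nhds hr)
    simpa only [Function.comp_def, zero_hmul, zero_smul, hexp_zero] using this
  obtain ⟨M, hM⟩ := hu.exists_le_box (R := max ‖hexp v‖ ‖hexp (-v)‖ + 1) (by positivity)
  have hM' : ∀ w : ℝ × ℝ, ‖hexp w‖ ≤ max ‖hexp v‖ ‖hexp (-v)‖ →
      ∀ᶠ i in F, u (hmul (G i) (hexp w)) ≤ M := by
    intro w hw
    filter_upwards [(hmv w).norm.eventually_le_const (lt_add_of_le_of_pos hw one_pos)] with i hi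
    obtain ⟨h1, h2⟩ := norm_prod_le_iff.1 hi
    obtain ⟨h2, h3⟩ := norm_prod_le_iff.1 h2
    exact hM _ _ _ h1 h2 h3
  have hr1 : ∀ᶠ i in F, |r i| ≤ 1 := by
    have := hr.abs
    rw [abs_zero] at this
    exact this.eventually_le_const one_pos
  have hev : ∀ᶠ i in F, (1 - |r i|) * (M - u (G i)) ≤ M - u (hmul (G i) (hexp (r i • v))) ∧
      M - u (hmul (G i) (hexp (r i • v))) ≤ (1 + |r i|) * (M - u (G i)) := by
    filter_upwards [hM' v (le_max_left _ _), hM' (-v) (le_max_right _ _), hr1] with i h1 h2 h3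
    exact hu.harnack h1 h2 h3
  have lo : Tendsto (fun i => (1 - |r i|) * (M - u (G i))) F (𝓝 (M - u 0)) := by
    simpa using (hr.abs.const_sub 1).mul (huG.const_sub M)
  have hi : Tendsto (fun i => (1 + |r i|) * (M - u (G i))) F (𝓝 (M - u 0)) := by
    simpa using (hr.abs.const_add 1).mul (huG.const_sub M)
  have := tendsto_of_tendsto_of_tendsto_of_le_of_le' lo hi (hev.mono fun _ h => h.1)
    (hev.mono fun _ h => h.2)
  simpa using this.const_sub M

lemma continuousAt_zero (hu : HConvexOn univ u) : ContinuousAt u 0 := by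
  set τ : Hgrp → ℝ := fun g => g.2.2 + 2 * g.1 * g.2.1 with hτ
  set a : Hgrp → ℝ := fun g => (√(τ g) + √(-τ g)) / 2 with ha
  set b : Hgrp → ℝ := fun g => (√(-τ g) - √(τ g)) / 2 with hb
  have hab : ∀ g, -2 * g.1 * g.2.1 - 4 * a g * b g = g.2.2 := by
    intro g
    have := sqrt_sq_sub_sqrt_neg_sq (τ g)
    simp only [ha, hb]
    simp only [hτ] at this ⊢
    linear_combination this
  have t0 : ∀ f : Hgrp → ℝ, Continuous f → f 0 = 0 → Tendsto f (𝓝 0) (𝓝 0) := by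
    intro f hf h0
    simpa [h0] using hf.tendsto 0
  have tx := t0 (fun g => g.1) (by fun_prop) (by simp)
  have ty := t0 (fun g => g.2.1) (by fun_prop) (by simp)
  have ta := t0 a (by fun_prop) (by simp [ha, hτ])
  have tb := t0 b (by fun_prop) (by simp [hb, hτ])
  have tna := t0 (fun g => -a g) (by fun_prop) (by simp [ha, hτ])
  have tnb := t0 (fun g => -b g) (by fun_prop) (by simp [hb, hτ])
  have s0 : Tendsto (fun _ : Hgrp => (0 : Hgrp)) (𝓝 0) (𝓝 0) ∧
      Tendsto (fun _ : Hgrp => u 0) (𝓝 0) (𝓝 (u 0)) := ⟨tendsto_const_nhds, tendsto_const_nhds⟩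
  have s1 := hu.tendsto_hmul_hexp (0, 1) (hu.tendsto_hmul_hexp (1, 0) s0 tx) ty
  have s2 := hu.tendsto_hmul_hexp (0, 1) (hu.tendsto_hmul_hexp (1, 0) s1 ta) tb
  have s3 := (hu.tendsto_hmul_hexp (0, 1) (hu.tendsto_hmul_hexp (1, 0) s2 tna) tnb).2
  refine s3.congr fun g => ?_
  simp only [Prod.smul_mk, smul_eq_mul, mul_zero, mul_one]
  rw [axis_chain, hab]
  simp [hmul]

protected lemma continuous (hu : HConvexOn univ u) : Continuous u := by
  refine continuous_iff_continuousAt.2 fun g => ?_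
  have h := (hu.comp_hmul g).continuousAt_zero
  have hinv_g : hmul (hinv g) g = 0 := by
    ext <;> simp only [hmul, hinv, Prod.fst_zero, Prod.snd_zero] <;> ring
  have hl : ContinuousAt (fun k => hmul (hinv g) k) g :=
    (continuous_hmul.comp (continuous_const.prodMk continuous_id)).continuousAt
  rw [← hinv_g] at h
  simpa [Function.comp_def, hmul_hinv_cancel_left] using
    ContinuousAt.comp (f := fun k => hmul (hinv g) k) h hl

/-! ### Existence of H-subgradients -/

/-- At a minimum of `u` plus a multiple of the squared Euclidean distance to `g₀`, minus the
horizontal gradient of the penalty is an H-subgradient of `u`. -/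
lemma mem_hsub_of_isLocalMin (hu : HConvexOn univ u) {g₀ k : Hgrp} {c : ℝ}
    (hk : IsLocalMin (fun g => u g + c * ((g.1 - g₀.1) ^ 2 + (g.2.1 - g₀.2.1) ^ 2 +
      (g.2.2 - g₀.2.2) ^ 2)) k) :
    (-2 * c * (k.1 - g₀.1 + 2 * k.2.1 * (k.2.2 - g₀.2.2)),
      -2 * c * (k.2.1 - g₀.2.1 - 2 * k.1 * (k.2.2 - g₀.2.2))) ∈ hsub univ u k := by
  rintro g ⟨hg, -⟩
  have hline : Tendsto (fun s : ℝ => k + s • (g - k)) (𝓝[>] 0) (𝓝 k) := by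
    have : Continuous fun s : ℝ => k + s • (g - k) := by fun_prop
    simpa using (this.tendsto 0).mono_left nhdsWithin_le_nhds
  set Q : ℝ := (g.1 - k.1) ^ 2 + (g.2.1 - k.2.1) ^ 2 + (g.2.2 - k.2.2) ^ 2 with hQ
  set P : ℝ := (k.1 - g₀.1) * (g.1 - k.1) + (k.2.1 - g₀.2.1) * (g.2.1 - k.2.1) +
    (k.2.2 - g₀.2.2) * (g.2.2 - k.2.2) with hP
  have hev : ∀ᶠ s : ℝ in 𝓝[>] 0, -(c * (2 * P + s * Q)) ≤ u g - u k := by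
    filter_upwards [hline.eventually hk, Ioo_mem_nhdsGT one_pos] with s hs hs01
    have h1 := hu.segment_le hg ⟨hs01.1.le, hs01.2.le⟩
    simp only [Prod.fst_add, Prod.snd_add, Prod.smul_fst, Prod.smul_snd, Prod.fst_sub,
      Prod.snd_sub, smul_eq_mul] at hs
    refine le_of_mul_le_mul_left ?_ hs01.1
    linear_combination hs + h1
  have hlim : Tendsto (fun s : ℝ => -(c * (2 * P + s * Q))) (𝓝[>] 0) (𝓝 (-(c * (2 * P)))) := by
    have : Continuous fun s : ℝ => -(c * (2 * P + s * Q)) := by fun_prop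
    simpa using (this.tendsto 0).mono_left nhdsWithin_le_nhds
  have key := le_of_tendsto hlim hev
  simp only [hplane, mem_ofPred_eq] at hg
  have hd : dot (-2 * c * (k.1 - g₀.1 + 2 * k.2.1 * (k.2.2 - g₀.2.2)),
      -2 * c * (k.2.1 - g₀.2.1 - 2 * k.1 * (k.2.2 - g₀.2.2))) (xi1 g - xi1 k)
      = -(c * (2 * P)) := by
    simp only [dot, xi1, hP, hg, Prod.fst_sub, Prod.snd_sub]; ring
  rw [hd]; linarith

/-- H-subgradients exist on a dense set. -/
lemma mem_closure_hsub_nonempty (hu : HConvexOn univ u) (g₀ : Hgrp) :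
    g₀ ∈ closure {k | (hsub univ u k).Nonempty} := by
  rw [Metric.mem_closure_iff]
  intro ε hε
  have hcpt := isCompact_closedBall g₀ (ε / 2)
  obtain ⟨m, hm, hmin⟩ := hcpt.exists_isMinOn ⟨g₀, Metric.mem_closedBall_self (half_pos hε).le⟩
    hu.continuous.continuousOn
  have hm' : 0 ≤ u g₀ - u m := sub_nonneg.2 (hmin (Metric.mem_closedBall_self (half_pos hε).le))
  set c : ℝ := (u g₀ - u m + 1) / (ε / 2) ^ 2 with hc
  have hcε : c * (ε / 2) ^ 2 = u g₀ - u m + 1 := by rw [hc]; field_simp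
  have hc0 : 0 < c := by positivity
  set θ : Hgrp → ℝ := fun g => (g.1 - g₀.1) ^ 2 + (g.2.1 - g₀.2.1) ^ 2 + (g.2.2 - g₀.2.2) ^ 2
    with hθ
  have hcont : Continuous fun g => u g + c * θ g := by
    have := hu.continuous
    fun_prop
  obtain ⟨k, hk, hkmin⟩ := hcpt.exists_isMinOn ⟨g₀, Metric.mem_closedBall_self (half_pos hε).le⟩ hcont.continuousOn
  have h0 : u k + c * θ k ≤ u g₀ := by
    have : u k + c * θ k ≤ u g₀ + c * θ g₀ := hkmin (Metric.mem_closedBall_self (half_pos hε).le)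
    simpa [hθ] using this
  have hθk : θ k < (ε / 2) ^ 2 := by
    have : u m ≤ u k := hmin hk
    refine lt_of_mul_lt_mul_left ?_ hc0.le
    linarith
  have hlt : dist k g₀ < ε / 2 := by
    have e := hθk
    simp only [hθ] at e
    rw [Prod.dist_eq, Prod.dist_eq, max_lt_iff, max_lt_iff]
    refine ⟨?_, ?_, ?_⟩ <;> rw [Real.dist_eq] <;>
      refine abs_lt_of_sq_lt_sq ?_ (by positivity) <;>
      nlinarith [sq_nonneg (k.1 - g₀.1), sq_nonneg (k.2.1 - g₀.2.1), sq_nonneg (k.2.2 - g₀.2.2)]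
  refine ⟨k, ⟨_, hu.mem_hsub_of_isLocalMin (g₀ := g₀) (c := c) ?_⟩, ?_⟩
  · exact hkmin.isLocalMin (Filter.mem_of_superset (Metric.isOpen_ball.mem_nhds hlt)
      Metric.ball_subset_closedBall)
  · rw [dist_comm]; linarith

lemma hsub_nonempty (hu : HConvexOn univ u) (g₀ : Hgrp) : (hsub univ u g₀).Nonempty := by
  obtain ⟨k, hk, hlim⟩ := mem_closure_iff_seq_limit.1 (hu.mem_closure_hsub_nonempty g₀)
  choose p hp using hk
  have hmv : ∀ v : ℝ × ℝ, Tendsto (fun n => u (hmul (k n) (hexp v))) atTop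
      (𝓝 (u (hmul g₀ (hexp v)))) := fun v =>
    (hu.continuous.tendsto _).comp ((continuous_hmul.tendsto (g₀, hexp v)).comp
      (hlim.prodMk_nhds tendsto_const_nhds))
  have hu0 : Tendsto (fun n => u (k n)) atTop (𝓝 (u g₀)) := (hu.continuous.tendsto _).comp hlim
  have hsubgrad : ∀ (v : ℝ × ℝ) n, dot (p n) v ≤ u (hmul (k n) (hexp v)) - u (k n) := by
    intro v n
    have h := hp n _ ⟨hmul_hexp_mem_hplane (k n) v, trivial⟩
    have e : xi1 (hmul (k n) (hexp v)) - xi1 (k n) = v := by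
      ext <;> simp [xi1, hmul, hexp]
    rw [e] at h
    linarith
  have hbdd : ∀ v : ℝ × ℝ, ∃ C, ∀ n, dot (p n) v ≤ C := by
    intro v
    obtain ⟨C, hC⟩ := ((hmv v).sub hu0).bddAbove_range
    exact ⟨C, fun n => (hsubgrad v n).trans (hC ⟨n, rfl⟩)⟩
  obtain ⟨C₁, h₁⟩ := hbdd (1, 0)
  obtain ⟨C₂, h₂⟩ := hbdd (-1, 0)
  obtain ⟨C₃, h₃⟩ := hbdd (0, 1)
  obtain ⟨C₄, h₄⟩ := hbdd (0, -1)
  simp only [dot, mul_one, mul_zero, add_zero, zero_add, mul_neg] at h₁ h₂ h₃ h₄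
  have hmem : ∀ n, p n ∈ Icc (-C₂) C₁ ×ˢ Icc (-C₄) C₃ := fun n =>
    ⟨⟨by linarith [h₂ n], h₁ n⟩, ⟨by linarith [h₄ n], h₃ n⟩⟩
  obtain ⟨q, -, φ, hφ, hq⟩ := (isCompact_Icc.prod isCompact_Icc).tendsto_subseq hmem
  refine ⟨q, ?_⟩
  rintro g ⟨hg, -⟩
  have hgv : hmul g₀ (hexp (xi1 g - xi1 g₀)) = g := by
    simp only [hplane, mem_ofPred_eq] at hg
    ext <;> simp only [hmul, hexp, xi1, Prod.fst_sub, Prod.snd_sub]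
    · ring
    · ring
    · rw [hg]; ring
  have hdot : Continuous fun w : ℝ × ℝ => dot w (xi1 g - xi1 g₀) := by unfold dot; fun_prop
  have key := le_of_tendsto_of_tendsto' ((hdot.tendsto q).comp hq)
    (((hmv (xi1 g - xi1 g₀)).sub hu0).comp hφ.tendsto_atTop) fun n => hsubgrad _ _
  rw [hgv] at key
  linarith

end HConvexOn

/-! ### Sums along horizontal chains -/

/-- `S` is the sum attached to a horizontal chain from `a` to `c` with the covectors chosen
by `P`. -/
inductive IsChainSum (P : Hgrp → ℝ × ℝ) (c : Hgrp) : Hgrp → ℝ → Prop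
  | refl : IsChainSum P c c 0
  | cons {a b : Hgrp} {S : ℝ} (hab : b ∈ hplane a) (h : IsChainSum P c b S) :
      IsChainSum P c a (dot (P a) (xi1 b - xi1 a) + S)

lemma IsChainSum.exists_seq {P : Hgrp → ℝ × ℝ} {a c : Hgrp} {S : ℝ} (h : IsChainSum P c a S) :
    ∃ n : ℕ, 0 < n ∧ ∃ k : ℕ → Hgrp, k 0 = a ∧ k n = c ∧ (∀ i < n, k (i + 1) ∈ hplane (k i)) ∧
      S = ∑ i ∈ Finset.range n, dot (P (k i)) (xi1 (k (i + 1)) - xi1 (k i)) := by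
  induction h with
  | refl => exact ⟨1, one_pos, fun _ => c, rfl, rfl, fun _ _ => mem_hplane_self c, by simp [dot]⟩
  | @cons a b S hab _ ih =>
    obtain ⟨n, -, k, h0, hn, hk, hS⟩ := ih
    refine ⟨n + 1, n.succ_pos, fun i => Nat.casesOn i a k, rfl, hn, ?_, ?_⟩
    · rintro (_ | i) hi
      · simpa [h0] using hab
      · exact hk i (by omega)
    · rw [Finset.sum_range_succ', hS, add_comm]
      simp [h0]

/-- Subdividing a horizontal segment into `N` equal parts. -/
lemma IsChainSum.exists_subdivision {u : Hgrp → ℝ} {P : Hgrp → ℝ × ℝ}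
    (hP : ∀ k, P k ∈ hsub univ u k) {a b c : Hgrp} {S : ℝ} (h : IsChainSum P c b S)
    (hab : b ∈ hplane a) (N : ℕ) (hN : 0 < N) :
    ∃ S', IsChainSum P c a S' ∧
      S + (u b - u a) - (N : ℝ)⁻¹ * dot (P b - P a) (xi1 b - xi1 a) ≤ S' := by
  have hN' : (N : ℝ) ≠ 0 := by positivity
  set pt : ℝ → Hgrp := fun r => a + r • (b - a) with hpt
  have pt1 : pt 1 = b := by simp [hpt]
  have pt0 : pt 0 = a := by simp [hpt]
  have hxi : ∀ r s : ℝ, xi1 (pt s) - xi1 (pt r) = (s - r) • (xi1 b - xi1 a) := by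
    intro r s
    ext <;> simp [hpt, xi1] <;> ring
  have main : ∀ j ≤ N, ∃ S', IsChainSum P c (pt (1 - j / N)) S' ∧
      S + (u b - u (pt (1 - j / N))) -
        (N : ℝ)⁻¹ * dot (P b - P (pt (1 - j / N))) (xi1 b - xi1 a) ≤ S' := by
    intro j
    induction j with
    | zero =>
      intro _
      refine ⟨S, by simpa [pt1] using h, ?_⟩
      simp [pt1, dot]
    | succ j ih =>
      intro hj
      obtain ⟨S', hS', hle⟩ := ih (by omega)
      set r : ℝ := 1 - (j + 1 : ℕ) / N with hr
      set s : ℝ := 1 - (j : ℝ) / N with hs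
      have hsr : s - r = (N : ℝ)⁻¹ := by
        rw [hs, hr]; push_cast; field_simp; ring
      have hrs : r - s = -(N : ℝ)⁻¹ := by linarith
      refine ⟨_, hS'.cons (segment_mem_hplane hab r s), ?_⟩
      have hsub := hP (pt s) (pt r) ⟨segment_mem_hplane hab s r, trivial⟩
      rw [hxi, hrs, dot_smul_right] at hsub
      rw [hxi, hsr, dot_smul_right]
      rw [dot_sub_left] at hle ⊢
      linarith
  have := main N le_rfl
  rwa [div_self hN', sub_self, pt0] at this

/-- The increment of `u` from `a` to `c` is approximated from below by sums along chains. -/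
def ChainApprox (u : Hgrp → ℝ) (P : Hgrp → ℝ × ℝ) (c a : Hgrp) : Prop :=
  ∀ ε > 0, ∃ S, IsChainSum P c a S ∧ u c - u a - ε ≤ S

namespace ChainApprox

variable {u : Hgrp → ℝ} {P : Hgrp → ℝ × ℝ}

lemma refl (u : Hgrp → ℝ) (P : Hgrp → ℝ × ℝ) (c : Hgrp) : ChainApprox u P c c :=
  fun ε hε => ⟨0, .refl, by linarith⟩

lemma cons (hP : ∀ k, P k ∈ hsub univ u k) {a b c : Hgrp} (hab : b ∈ hplane a)
    (h : ChainApprox u P c b) : ChainApprox u P c a := by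
  intro ε hε
  obtain ⟨S, hS, hle⟩ := h (ε / 2) (half_pos hε)
  have hlim : Tendsto (fun N : ℕ => (N : ℝ)⁻¹ * dot (P b - P a) (xi1 b - xi1 a)) atTop (𝓝 0) := by
    simpa using (tendsto_inv_atTop_nhds_zero_nat (𝕜 := ℝ)).mul_const
      (dot (P b - P a) (xi1 b - xi1 a))
  obtain ⟨N, hN, hN0⟩ :=
    ((hlim.eventually_le_const (half_pos hε)).and (eventually_gt_atTop 0)).exists
  obtain ⟨S', hS', hle'⟩ := hS.exists_subdivision hP hab N hN0
  exact ⟨S', hS', by linarith⟩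

lemma of_hsub (hP : ∀ k, P k ∈ hsub univ u k) (a c : Hgrp) : ChainApprox u P c a := by
  have hmove : ∀ (g : Hgrp) (v : ℝ × ℝ), ChainApprox u P c (hmul g (hexp v)) →
      ChainApprox u P c g := fun g v => cons hP (hmul_hexp_mem_hplane g v)
  set d := hmul (hinv a) c with hd
  have e : hmul a (d.1, d.2.1, -2 * d.1 * d.2.1 -
      4 * 1 * (-(d.2.2 + 2 * d.1 * d.2.1) / 4)) = c := by
    have : (d.1, d.2.1, -2 * d.1 * d.2.1 - 4 * 1 * (-(d.2.2 + 2 * d.1 * d.2.1) / 4)) = d := by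
      ext <;> simp only []
      ring
    rw [this, hd, hmul_hinv_cancel_left]
  rw [← axis_chain] at e
  exact hmove a (d.1, 0) <| hmove _ (0, d.2.1) <| hmove _ (1, 0) <|
    hmove _ (0, -(d.2.2 + 2 * d.1 * d.2.1) / 4) <| hmove _ (-1, 0) <|
    hmove _ (0, -(-(d.2.2 + 2 * d.1 * d.2.1) / 4)) <| by rw [e]; exact refl u P c

end ChainApprox

/-- Sums of H-subgradients along a horizontal chain do not exceed the increment of `u`. -/
lemma sum_dot_le {u : Hgrp → ℝ} {h : ℕ → Hgrp} {p : ℕ → ℝ × ℝ} {n : ℕ}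
    (hh : ∀ i < n, h (i + 1) ∈ hplane (h i)) (hp : ∀ i ≤ n, p i ∈ hsub univ u (h i)) :
    ∑ i ∈ Finset.range n, dot (p i) (xi1 (h (i + 1)) - xi1 (h i)) ≤ u (h n) - u (h 0) := by
  rw [← Finset.sum_range_sub (fun i => u (h i)) n]
  refine Finset.sum_le_sum fun i hi => ?_
  have hi' := Finset.mem_range.1 hi
  linarith [hp i hi'.le _ ⟨hh i hi', trivial⟩]

/-- the Rockafellar-type integration formula: an H-convex function is
recovered from its H-subdifferential by a supremum of Riemann–Stieltjes-type sums along
horizontal chains from `g₀` to `g`. -/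
theorem stmt17 (u : Hgrp → ℝ) (hu : HConvexOn Set.univ u) (g0 g : Hgrp) :
    u g = u g0 + sSup {S : ℝ | ∃ n : ℕ, 0 < n ∧ ∃ h : ℕ → Hgrp, ∃ p : ℕ → ℝ × ℝ,
      h 0 = g0 ∧ h n = g ∧ (∀ i < n, h (i + 1) ∈ hplane (h i)) ∧
      (∀ i ≤ n, p i ∈ hsub Set.univ u (h i)) ∧
      S = ∑ i ∈ Finset.range n, dot (p i) (xi1 (h (i + 1)) - xi1 (h i))} := by
  choose P hP using hu.hsub_nonempty
  suffices h : IsLUB {S : ℝ | ∃ n : ℕ, 0 < n ∧ ∃ h : ℕ → Hgrp, ∃ p : ℕ → ℝ × ℝ,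
      h 0 = g0 ∧ h n = g ∧ (∀ i < n, h (i + 1) ∈ hplane (h i)) ∧
      (∀ i ≤ n, p i ∈ hsub Set.univ u (h i)) ∧
      S = ∑ i ∈ Finset.range n, dot (p i) (xi1 (h (i + 1)) - xi1 (h i))} (u g - u g0) by
    rw [h.csSup_eq h.nonempty]; ring
  refine ⟨?_, fun B hB => le_of_forall_pos_sub_le fun ε hε => ?_⟩
  · rintro S ⟨n, -, h, p, rfl, rfl, hh, hp, rfl⟩
    exact sum_dot_le hh hp
  · obtain ⟨S, hS, hle⟩ := ChainApprox.of_hsub hP g0 g ε hε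
    obtain ⟨n, hn, k, h0, hkn, hk, hsum⟩ := hS.exists_seq
    exact hle.trans (hB ⟨n, hn, k, fun i => P (k i), h0, hkn, hk, fun i _ => hP _, hsum⟩)
end
end
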